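/- Fix an integer d ≥ 3 and a constant K > 0. There exists a finite constant C > 0, depending only on d and K, with the following property. Let A(n) ≥ 1 and λ(n) ∈ ℝ be sequences with A(n) = o(n^{1/30}) and |λ(n)| ≤ K·A(n); set p = p(n) = (1 + λ(n)n^{−1/3})/(d−1), T' = T'(n) = ⌊n^{2/3}/A(n)²⌋, and ν = ν(n) = (1/(d−1))·log(1 − p(1 − T'/n)) − (1/(d−1))·log((d−2)·p(1 − T'/n)). For each n let Δ be a random variable with P(Δ = d−2) = p(1 − T'/n) and P(Δ = −1) = 1 − p(1 − T'/n). Then for all sufficiently large n: (i) |ν − T'/(n(d−2)) + λ/(n^{1/3}(d−2))| ≤ C·(λ²n^{−2/3} + |λ|T'·n^{−4/3} + (T')²·n^{−2}); and (ii) |log E[e^{ν·Δ}]| ≤ C·(λ²n^{−2/3} + |λ|T'·n^{−4/3} + (T')²·n^{−2}). -/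

import Mathlib

open MeasureTheory ProbabilityTheory Filter Asymptotics
open scoped ENNReal

/-- The percolation parameter `p = p(n) = (1 + λ n^{-1/3})/(d-1)`. -/
noncomputable def pOf (d : ℕ) (lam : ℝ) (n : ℕ) : ℝ :=
  (1 + lam * (n : ℝ) ^ (-(1 : ℝ) / 3)) / ((d : ℝ) - 1)

/-- `T' = ⌊n^{2/3}/A²⌋`. -/
noncomputable def T'Of (A : ℝ) (n : ℕ) : ℕ :=
  (⌊(n : ℝ) ^ ((2 : ℝ) / 3) / A ^ 2⌋).toNat

/-- The tilting parameter
`ν = (1/(d-1))·log(1 - p(1 - T'/n)) - (1/(d-1))·log((d-2)·p(1 - T'/n))`. -/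
noncomputable def nuOf (d : ℕ) (lam A : ℝ) (n : ℕ) : ℝ :=
  (1 / ((d : ℝ) - 1)) * Real.log (1 - pOf d lam n * (1 - (T'Of A n : ℝ) / n))
    - (1 / ((d : ℝ) - 1)) * Real.log (((d : ℝ) - 2) * pOf d lam n * (1 - (T'Of A n : ℝ) / n))

theorem abs_log_one_add_sub_self_le {x : ℝ} (hx : |x| ≤ 1 / 2) :
    |Real.log (1 + x) - x| ≤ 2 * x ^ 2 := by
  have h := Real.abs_log_sub_add_sum_range_le (x := -x) (by rw [abs_neg]; linarith) 1
  simp only [Finset.range_one, Finset.sum_singleton, abs_neg, sub_neg_eq_add] at h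
  norm_num at h
  rw [neg_add_eq_sub] at h
  refine h.trans ?_
  rw [div_le_iff₀ (by linarith)]
  nlinarith [sq_nonneg x]

/-- The integral of a function of a random variable supported on two points. -/
theorem integral_comp_of_two_points {Ω : Type*} [MeasurableSpace Ω] {μ : Measure Ω}
    [IsProbabilityMeasure μ] {X : Ω → ℝ} (hX : Measurable X) {u v q : ℝ} (huv : u ≠ v)
    (hq0 : 0 ≤ q) (hq1 : q ≤ 1)
    (hu : μ {ω | X ω = u} = ENNReal.ofReal q) (hv : μ {ω | X ω = v} = ENNReal.ofReal (1 - q))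
    (g : ℝ → ℝ) :
    ∫ ω, g (X ω) ∂μ = q * g u + (1 - q) * g v := by
  have hSu : MeasurableSet {ω | X ω = u} := hX (measurableSet_singleton u)
  have hSv : MeasurableSet {ω | X ω = v} := hX (measurableSet_singleton v)
  have hdisj : Disjoint {ω | X ω = u} {ω | X ω = v} :=
    Set.disjoint_left.2 fun ω h₁ h₂ => huv (h₁.symm.trans h₂)
  have hunion : μ ({ω | X ω = u} ∪ {ω | X ω = v}) = 1 := by
    rw [measure_union hdisj hSv, hu, hv, ← ENNReal.ofReal_add hq0 (by linarith)]
    simp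
  have hae : ∀ᵐ ω ∂μ, ω ∈ {ω | X ω = u} ∪ {ω | X ω = v} :=
    (mem_ae_iff_prob_eq_one (hSu.union hSv)).2 hunion
  have hcongr : (fun ω => g (X ω)) =ᵐ[μ] fun ω =>
      {ω | X ω = u}.indicator (fun _ => g u) ω + {ω | X ω = v}.indicator (fun _ => g v) ω := by
    filter_upwards [hae] with ω hω
    rcases hω with h | h
    · have h' : X ω = u := h
      simp [h', huv]
    · have h' : X ω = v := h
      simp [h', huv.symm]
  rw [integral_congr_ae hcongr, integral_add ((integrable_const _).indicator hSu)
    ((integrable_const _).indicator hSv), integral_indicator_const _ hSu,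
    integral_indicator_const _ hSv, measureReal_def, measureReal_def, hu, hv,
    ENNReal.toReal_ofReal hq0, ENNReal.toReal_ofReal (by linarith)]
  simp

/-- First-order expansion of the exponential tilting parameter making a variable with values
`m - 1` and `-1` centred, when the success probability is `(1 + x) / m`. -/
theorem abs_tilt_add_le {m x : ℝ} (hm : 2 ≤ m) (hx : |x| ≤ 1 / 2) :
    |1 / m * Real.log (1 - (1 + x) / m) - 1 / m * Real.log ((m - 1) * ((1 + x) / m))
      + x / (m - 1)| ≤ 2 * x ^ 2 ∧
    |Real.log (1 - x / (m - 1)) + x / (m - 1)| ≤ 2 * x ^ 2 := by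
  obtain ⟨hx1, hx2⟩ := abs_le.1 hx
  have hm1 : 1 ≤ m - 1 := by linarith
  have hm0 : 0 < m - 1 := by linarith
  have hm00 : 0 < m := by linarith
  set y := x / (m - 1) with hy
  have hyx : |y| ≤ |x| := by
    rw [hy, abs_div, abs_of_pos hm0]
    exact div_le_self (abs_nonneg x) hm1
  have hxy : x = (m - 1) * y := by rw [hy]; field_simp
  have hy1 := abs_le.1 (hyx.trans hx)
  have h1 := abs_log_one_add_sub_self_le hx
  have h2 := abs_log_one_add_sub_self_le (x := -y) (by rw [abs_neg]; exact hyx.trans hx)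
  have hsq : y ^ 2 ≤ x ^ 2 := sq_le_sq.2 hyx
  have h3 : |Real.log (1 - y) + y| ≤ 2 * x ^ 2 := by
    rw [sub_neg_eq_add, ← sub_eq_add_neg, neg_sq] at h2
    linarith
  refine ⟨?_, h3⟩
  have e1 : 1 - (1 + x) / m = (m - 1) / m * (1 - y) := by
    rw [hy]; field_simp; ring
  have e2 : (m - 1) * ((1 + x) / m) = (m - 1) / m * (1 + x) := by ring
  have hmm : (m - 1) / m ≠ 0 := by positivity
  rw [e1, e2, Real.log_mul hmm (by linarith), Real.log_mul hmm (by linarith)]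
  have e3 : 1 / m * (Real.log ((m - 1) / m) + Real.log (1 - y))
      - 1 / m * (Real.log ((m - 1) / m) + Real.log (1 + x)) + y
      = 1 / m * ((Real.log (1 - y) + y) - (Real.log (1 + x) - x)) := by
    rw [hxy]; field_simp; ring
  rw [e3, abs_mul, abs_of_pos (by positivity : 0 < 1 / m)]
  have h4 := abs_sub (Real.log (1 - y) + y) (Real.log (1 + x) - x)
  have h5 : 1 / m ≤ 1 / 2 := one_div_le_one_div_of_le two_pos hm
  calc _ ≤ 1 / 2 * (4 * x ^ 2) := by
        gcongr
        linarith
    _ = _ := by ring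

/-- The logarithm of the moment generating function at the tilting parameter. -/
theorem log_mgf_tilt_eq {m x : ℝ} (hm : 2 ≤ m) (hx : |x| ≤ 1 / 2) {ν : ℝ}
    (hν : ν = 1 / m * Real.log (1 - (1 + x) / m)
      - 1 / m * Real.log ((m - 1) * ((1 + x) / m))) :
    Real.log ((1 + x) / m * Real.exp (ν * (m - 1))
      + (1 - (1 + x) / m) * Real.exp (ν * -1)) = Real.log (1 - x / (m - 1)) - ν := by
  obtain ⟨hx1, hx2⟩ := abs_le.1 hx
  have hm0 : 0 < m - 1 := by linarith
  have hm00 : 0 < m := by linarith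
  have hq : 0 < (1 + x) / m := div_pos (by linarith) hm00
  have hq1 : 0 < 1 - (1 + x) / m := by
    rw [sub_pos, div_lt_one hm00]; linarith
  have hy : 0 < 1 - x / (m - 1) := by
    rw [sub_pos, div_lt_one hm0]; linarith
  have hmν : ν * m = Real.log (1 - (1 + x) / m) - Real.log ((m - 1) * ((1 + x) / m)) := by
    rw [hν]; field_simp
  have hexp : Real.exp (ν * (m - 1))
      = (1 - (1 + x) / m) / ((m - 1) * ((1 + x) / m)) * Real.exp (-ν) := by
    rw [show ν * (m - 1) = ν * m + -ν by ring, Real.exp_add, hmν, Real.exp_sub,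
      Real.exp_log hq1, Real.exp_log (mul_pos hm0 hq)]
  have hsum : (1 + x) / m * Real.exp (ν * (m - 1)) + (1 - (1 + x) / m) * Real.exp (ν * -1)
      = (1 - x / (m - 1)) * Real.exp (-ν) := by
    have h1x : 1 + x ≠ 0 := by linarith
    rw [hexp, mul_neg_one]
    field_simp
    ring
  rw [hsum, Real.log_mul hy.ne' (Real.exp_ne_zero _), Real.log_exp]
  ring

theorem error_terms_eq (l T : ℝ) {r : ℝ} (hr : 0 < r) :
    l ^ 2 * r ^ (-(2 : ℝ) / 3) + |l| * T * r ^ (-(4 : ℝ) / 3) + T ^ 2 * r ^ (-(2 : ℝ))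
      = |l * r ^ (-(1 : ℝ) / 3)| ^ 2 + |l * r ^ (-(1 : ℝ) / 3)| * (T / r) + (T / r) ^ 2 := by
  have e1 : r ^ (-(2 : ℝ) / 3) = (r ^ (-(1 : ℝ) / 3)) ^ 2 := by
    rw [← Real.rpow_natCast, ← Real.rpow_mul hr.le]; norm_num
  have e2 : r ^ (-(4 : ℝ) / 3) = r ^ (-(1 : ℝ) / 3) * r⁻¹ := by
    rw [← Real.rpow_neg_one, ← Real.rpow_add hr]; norm_num
  have e3 : r ^ (-(2 : ℝ)) = r⁻¹ ^ 2 := by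
    rw [Real.rpow_neg hr.le, inv_pow]; norm_num
  rw [e1, e2, e3, sq_abs, abs_mul, abs_of_pos (by positivity : 0 < r ^ (-(1 : ℝ) / 3))]
  ring

theorem abs_perturbation_le {a t : ℝ} (ha : |a| ≤ 1 / 5) (ht0 : 0 ≤ t) (ht : t ≤ 1 / 5) :
    |a - t - a * t| ≤ 1 / 2 ∧ (a - t - a * t) ^ 2 ≤ 3 * (|a| ^ 2 + |a| * t + t ^ 2) := by
  have hxabs : |a - t - a * t| ≤ 6 / 5 * |a| + t := by
    have h2 := abs_sub (a - t) (a * t)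
    have h3 := abs_sub a t
    rw [abs_of_nonneg ht0] at h3
    rw [abs_mul, abs_of_nonneg ht0] at h2
    nlinarith [abs_nonneg a]
  refine ⟨by linarith, ?_⟩
  have h1 : |a - t - a * t| ^ 2 ≤ (6 / 5 * |a| + t) ^ 2 := by gcongr
  rw [sq_abs] at h1
  nlinarith [mul_nonneg (abs_nonneg a) ht0, sq_nonneg |a|, sq_nonneg t]

theorem T'Of_le {A : ℝ} (hA : 1 ≤ A) (n : ℕ) : (T'Of A n : ℝ) ≤ (n : ℝ) ^ ((2 : ℝ) / 3) := by
  have h0 : 0 ≤ (n : ℝ) ^ ((2 : ℝ) / 3) := by positivity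
  have h1 : T'Of A n = ⌊(n : ℝ) ^ ((2 : ℝ) / 3) / A ^ 2⌋₊ := rfl
  rw [h1]
  exact (Nat.floor_le (by positivity)).trans (div_le_self h0 (one_le_pow₀ hA))

/-- The asymptotics of the tilting parameter `ν` and of the tilted moment
generating function `E[e^{νΔ}]`. -/
theorem stmt10 (d : ℕ) (hd : 3 ≤ d) (K : ℝ) (hK : 0 < K) :
    ∃ C : ℝ, 0 < C ∧
      ∀ A lam : ℕ → ℝ,
        (∀ n, 1 ≤ A n) →
        A =o[atTop] (fun n => (n : ℝ) ^ ((1 : ℝ) / 30)) →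
        (∀ n, |lam n| ≤ K * A n) →
        ∀ (Ω : ℕ → Type) (mΩ : ∀ n, MeasurableSpace (Ω n)) (μ : ∀ n, Measure (Ω n)),
          (∀ n, IsProbabilityMeasure (μ n)) →
          ∀ Δ : ∀ n, Ω n → ℝ,
            (∀ n, Measurable (Δ n)) →
            (∀ n, μ n {ω | Δ n ω = (d : ℝ) - 2}
              = ENNReal.ofReal (pOf d (lam n) n * (1 - (T'Of (A n) n : ℝ) / n))) →
            (∀ n, μ n {ω | Δ n ω = -1}
              = ENNReal.ofReal (1 - pOf d (lam n) n * (1 - (T'Of (A n) n : ℝ) / n))) →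
            ∀ᶠ n : ℕ in atTop,
              |nuOf d (lam n) (A n) n - (T'Of (A n) n : ℝ) / (n * ((d : ℝ) - 2))
                  + lam n / ((n : ℝ) ^ ((1 : ℝ) / 3) * ((d : ℝ) - 2))|
                ≤ C * ((lam n) ^ 2 * (n : ℝ) ^ (-(2 : ℝ) / 3)
                    + |lam n| * (T'Of (A n) n : ℝ) * (n : ℝ) ^ (-(4 : ℝ) / 3)
                    + (T'Of (A n) n : ℝ) ^ 2 * (n : ℝ) ^ (-(2 : ℝ))) ∧
              |Real.log (∫ ω, Real.exp (nuOf d (lam n) (A n) n * Δ n ω) ∂ μ n)|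
                ≤ C * ((lam n) ^ 2 * (n : ℝ) ^ (-(2 : ℝ) / 3)
                    + |lam n| * (T'Of (A n) n : ℝ) * (n : ℝ) ^ (-(4 : ℝ) / 3)
                    + (T'Of (A n) n : ℝ) ^ 2 * (n : ℝ) ^ (-(2 : ℝ))) := by
  refine ⟨12, by norm_num, ?_⟩
  intro A lam hA hAo hlam Ω mΩ μ hμ Δ hΔ hup hdown
  have hroot : Tendsto (fun n : ℕ => (n : ℝ) ^ (-((1 : ℝ) / 3))) atTop (nhds 0) :=
    (tendsto_rpow_neg_atTop (by norm_num)).comp tendsto_natCast_atTop_atTop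
  filter_upwards [hAo.bound (show 0 < 1 / (5 * K) by positivity), eventually_ge_atTop 1,
    hroot.eventually (ge_mem_nhds (show (0 : ℝ) < 1 / 5 by norm_num))] with n hn hn1 hn5
  have hn1' : (1 : ℝ) ≤ n := by exact_mod_cast hn1
  have hn0 : (0 : ℝ) < n := by linarith
  have hm : (2 : ℝ) ≤ (d : ℝ) - 1 := by
    have : (3 : ℝ) ≤ d := by exact_mod_cast hd
    linarith
  have hdm : (d : ℝ) - 2 = (d : ℝ) - 1 - 1 := by ring
  have hthird : (n : ℝ) ^ (-(1 : ℝ) / 3) = ((n : ℝ) ^ ((1 : ℝ) / 3))⁻¹ := by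
    rw [← Real.rpow_neg hn0.le]; norm_num
  set a := lam n * (n : ℝ) ^ (-(1 : ℝ) / 3) with ha
  set t := (T'Of (A n) n : ℝ) / n with ht
  have ht0 : 0 ≤ t := by positivity
  have ht5 : t ≤ 1 / 5 := by
    refine le_trans ?_ hn5
    rw [ht, div_le_iff₀ hn0]
    refine (T'Of_le (hA n) n).trans_eq ?_
    rw [← Real.rpow_add_one hn0.ne']
    norm_num
  have ha5 : |a| ≤ 1 / 5 := by
    have h1 : |lam n| ≤ 1 / 5 * (n : ℝ) ^ ((1 : ℝ) / 3) := by
      rw [Real.norm_of_nonneg (zero_le_one.trans (hA n)),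
        Real.norm_of_nonneg (by positivity)] at hn
      calc |lam n| ≤ K * A n := hlam n
        _ ≤ K * (1 / (5 * K) * (n : ℝ) ^ ((1 : ℝ) / 30)) := by gcongr
        _ = 1 / 5 * (n : ℝ) ^ ((1 : ℝ) / 30) := by field_simp
        _ ≤ 1 / 5 * (n : ℝ) ^ ((1 : ℝ) / 3) := by
          gcongr 1 / 5 * ?_
          exact Real.rpow_le_rpow_of_exponent_le hn1' (by norm_num)
    rw [ha, hthird, abs_mul, abs_inv, abs_of_pos (by positivity : 0 < (n : ℝ) ^ ((1 : ℝ) / 3)),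
      ← div_eq_mul_inv, div_le_iff₀ (by positivity)]
    exact h1
  have hE := error_terms_eq (lam n) (T'Of (A n) n : ℝ) hn0
  rw [← ha, ← ht] at hE
  rw [hE]
  set x := a - t - a * t with hx
  obtain ⟨hx2, hxsq⟩ := abs_perturbation_le ha5 ht0 ht5
  rw [← hx] at hx2 hxsq
  have hp : pOf d (lam n) n * (1 - t) = (1 + x) / ((d : ℝ) - 1) := by
    rw [pOf, ← ha, hx]; ring
  have hν : nuOf d (lam n) (A n) n
      = 1 / ((d : ℝ) - 1) * Real.log (1 - (1 + x) / ((d : ℝ) - 1))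
        - 1 / ((d : ℝ) - 1) * Real.log (((d : ℝ) - 1 - 1) * ((1 + x) / ((d : ℝ) - 1))) := by
    rw [nuOf, ← ht, mul_assoc ((d : ℝ) - 2), hp, hdm]
  obtain ⟨hb1, hb2⟩ := abs_tilt_add_le hm hx2
  rw [← hν] at hb1
  have hat : 0 ≤ |a| * t := by positivity
  constructor
  · have e : nuOf d (lam n) (A n) n - (T'Of (A n) n : ℝ) / (n * ((d : ℝ) - 2))
        + lam n / ((n : ℝ) ^ ((1 : ℝ) / 3) * ((d : ℝ) - 2))
        = (nuOf d (lam n) (A n) n + x / ((d : ℝ) - 1 - 1)) + a * t / ((d : ℝ) - 1 - 1) := by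
      have e1 : (T'Of (A n) n : ℝ) / (n * ((d : ℝ) - 2)) = t / ((d : ℝ) - 1 - 1) := by
        rw [ht, hdm, div_div]
      have e2 : lam n / ((n : ℝ) ^ ((1 : ℝ) / 3) * ((d : ℝ) - 2)) = a / ((d : ℝ) - 1 - 1) := by
        rw [ha, hthird, hdm, ← div_div, div_eq_mul_inv (lam n)]
      rw [e1, e2, hx]
      ring
    rw [e]
    have h1 : |a * t / ((d : ℝ) - 1 - 1)| ≤ |a| * t := by
      rw [abs_div, abs_mul, abs_of_nonneg ht0, abs_of_pos (by linarith : 0 < (d : ℝ) - 1 - 1)]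
      exact div_le_self hat (by linarith)
    refine (abs_add_le _ _).trans ?_
    nlinarith [sq_nonneg |a|, sq_nonneg t]
  · have := hμ n
    obtain ⟨hx3, hx4⟩ := abs_le.1 hx2
    have hu := hup n
    have hv := hdown n
    rw [← ht, hp, hdm] at hu
    rw [← ht, hp] at hv
    have hm0 : 0 < (d : ℝ) - 1 := by linarith
    have hne : (d : ℝ) - 1 - 1 ≠ -1 := (by linarith : (-1 : ℝ) < (d : ℝ) - 1 - 1).ne'
    have hq0 : 0 ≤ (1 + x) / ((d : ℝ) - 1) := div_nonneg (by linarith) hm0.le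
    have hq1 : (1 + x) / ((d : ℝ) - 1) ≤ 1 := (div_le_one hm0).2 (by linarith)
    have hint := integral_comp_of_two_points (hΔ n) hne hq0 hq1 hu hv
      (fun s => Real.exp (nuOf d (lam n) (A n) n * s))
    rw [hint, log_mgf_tilt_eq hm hx2 hν]
    have h1 := abs_sub (Real.log (1 - x / ((d : ℝ) - 1 - 1)) + x / ((d : ℝ) - 1 - 1))
      (nuOf d (lam n) (A n) n + x / ((d : ℝ) - 1 - 1))
    rw [add_sub_add_right_eq_sub] at h1
    linarith
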